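/- Let m, n ≥ 2 with gcd(m,n) = p > 1, write m = pa and n = pb. Then in ℕ ⋊ ℕ× (multiplication (r,x)(s,y) = (r + xs, xy)) one has (0,n)(p,1-type identities): p + 0·(pb) = p + 0·(pa) and p + a·(pb) = p + b·(pa); consequently in the 2-graph semigroup 𝔽θ+ built from the adding machine bijection θ, the elements corresponding to (p, mn) admit two incomparable factorizations, so 𝔽θ+ is not a right LCM semigroup. Conversely, if gcd(m,n) = 1, then the submonoid of ℕ ⋊ ℕ× generated by {(0,m),…,(m−1,m)} ∪ {(0,n),…,(n−1,n)} is a right LCM semigroup. -/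

import Mathlib

def IsRightMul {P : Type*} (mul : P → P → P) (p r : P) : Prop := ∃ q, mul p q = r

def IsRCM {P : Type*} (mul : P → P → P) (p q r : P) : Prop :=
  IsRightMul mul p r ∧ IsRightMul mul q r

def IsRLCM {P : Type*} (mul : P → P → P) (p q r : P) : Prop :=
  IsRCM mul p q r ∧ ∀ s, IsRCM mul p q s → IsRightMul mul r s

def nmul (p q : ℕ × ℕ) : ℕ × ℕ := (p.1 + p.2 * q.1, p.2 * q.2)

def Umem (p : ℕ × ℕ) : Prop := 1 ≤ p.2 ∧ p.1 < p.2

def URmul (p r : ℕ × ℕ) : Prop := ∃ q, Umem q ∧ nmul p q = r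

def URCM (p q r : ℕ × ℕ) : Prop := URmul p r ∧ URmul q r

def URLCM (p q r : ℕ × ℕ) : Prop := URCM p q r ∧ ∀ s, URCM p q s → URmul r s

/-- The generators of the submonoid of ℕ ⋊ ℕ× coming from the two adding machines. -/
def genSet (m n : ℕ) : Set (ℕ × ℕ) :=
  {p | (∃ i < m, p = (i, m)) ∨ (∃ j < n, p = (j, n))}

/-- Membership in the submonoid of ℕ ⋊ ℕ× generated by `genSet m n`. -/
inductive InSub (m n : ℕ) : ℕ × ℕ → Prop
  | one : InSub m n (0, 1)
  | gen {p} : p ∈ genSet m n → InSub m n p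
  | mul {p q} : InSub m n p → InSub m n q → InSub m n (nmul p q)

def SRmul (m n : ℕ) (p r : ℕ × ℕ) : Prop := ∃ q, InSub m n q ∧ nmul p q = r

def SRCM (m n : ℕ) (p q r : ℕ × ℕ) : Prop := SRmul m n p r ∧ SRmul m n q r

def SRLCM (m n : ℕ) (p q r : ℕ × ℕ) : Prop :=
  SRCM m n p q r ∧ ∀ s, SRCM m n p q s → SRmul m n r s

/-- The defining relations of the 2-graph semigroup `𝔽θ⁺`:
`y_j x_i = x_{i'} y_{j'}` whenever `j + i n = i' + j' m`. -/
def FTrel (m n : ℕ) :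
    FreeMonoid (Fin m ⊕ Fin n) → FreeMonoid (Fin m ⊕ Fin n) → Prop :=
  fun u v => ∃ (j : Fin n) (i : Fin m) (i' : Fin m) (j' : Fin n),
    (j : ℕ) + (i : ℕ) * n = (i' : ℕ) + (j' : ℕ) * m ∧
    u = FreeMonoid.of (Sum.inr j) * FreeMonoid.of (Sum.inl i) ∧
    v = FreeMonoid.of (Sum.inl i') * FreeMonoid.of (Sum.inr j')

/-- `𝔽θ⁺` as a quotient of the free monoid by the congruence generated by `FTrel`. -/
abbrev FTheta (m n : ℕ) := (conGen (FTrel m n)).Quotient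

/-- The right LCM property for a monoid: left cancellative, and any two elements
with a right common multiple have a right least common multiple. -/
def RightLCMMonoid (P : Type*) [Monoid P] : Prop :=
  (∀ a b c : P, a * b = a * c → b = c) ∧
  ∀ p q : P, (∃ w, IsRCM (· * · : P → P → P) p q w) → ∃ w, IsRLCM (· * · : P → P → P) p q w

theorem inSub_pow {m n k : ℕ} (hk : 0 < k) (h : ∀ i < k, InSub m n (i, k)) :
    ∀ a r : ℕ, r < k ^ a → InSub m n (r, k ^ a)
  | 0, r, hr => by
    obtain rfl : r = 0 := by simpa using hr
    simpa using InSub.one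
  | a + 1, r, hr => by
    have hq : r / k < k ^ a := Nat.div_lt_of_lt_mul (by rwa [pow_succ'] at hr)
    have := (h (r % k) (Nat.mod_lt _ hk)).mul (inSub_pow hk h a (r / k) hq)
    simpa [nmul, Nat.mod_add_div, pow_succ'] using this

theorem nmul_fst_lt {p q : ℕ × ℕ} (hp : p.1 < p.2) (hq : q.1 < q.2) :
    (nmul p q).1 < (nmul p q).2 :=
  calc p.1 + p.2 * q.1 < p.2 * (q.1 + 1) := by rw [mul_add, mul_one]; omega
    _ ≤ p.2 * q.2 := Nat.mul_le_mul_left _ hq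

theorem inSub_iff {m n : ℕ} (hm : 0 < m) (hn : 0 < n) {p : ℕ × ℕ} :
    InSub m n p ↔ (∃ a b, p.2 = m ^ a * n ^ b) ∧ p.1 < p.2 := by
  constructor
  · intro h
    induction h with
    | one => exact ⟨⟨0, 0, by simp⟩, by simp⟩
    | gen h =>
      obtain ⟨i, hi, rfl⟩ | ⟨i, hi, rfl⟩ := h
      · exact ⟨⟨1, 0, by simp⟩, hi⟩
      · exact ⟨⟨0, 1, by simp⟩, hi⟩
    | mul _ _ hp hq =>
      obtain ⟨⟨a, b, hab⟩, hp⟩ := hp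
      obtain ⟨⟨c, d, hcd⟩, hq⟩ := hq
      refine ⟨⟨a + c, b + d, ?_⟩, nmul_fst_lt hp hq⟩
      simp only [nmul, hab, hcd]
      ring
  · obtain ⟨r, x⟩ := p
    rintro ⟨⟨a, b, rfl : x = _⟩, hr : r < _⟩
    have hma : 0 < m ^ a := Nat.pow_pos hm
    have h₁ := inSub_pow hm (n := n) (fun i hi => .gen (.inl ⟨i, hi, rfl⟩)) a _
      (Nat.mod_lt r hma)
    have h₂ := inSub_pow hn (m := m) (fun i hi => .gen (.inr ⟨i, hi, rfl⟩)) b _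
      (Nat.div_lt_of_lt_mul hr)
    simpa [nmul, Nat.mod_add_div] using h₁.mul h₂

theorem sRmul_iff {m n : ℕ} (hm : 0 < m) (hn : 0 < n) {p r : ℕ × ℕ} (hp : p.1 < p.2) :
    SRmul m n p r ↔
      (∃ a b, r.2 = p.2 * (m ^ a * n ^ b)) ∧ r.1 < r.2 ∧ r.1 ≡ p.1 [MOD p.2] := by
  constructor
  · rintro ⟨q, hq, rfl⟩
    obtain ⟨⟨a, b, hab⟩, hlt⟩ := (inSub_iff hm hn).1 hq
    refine ⟨⟨a, b, by simp [nmul, hab]⟩, nmul_fst_lt hp hlt, ?_⟩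
    simp [nmul, Nat.ModEq]
  · rintro ⟨⟨a, b, hab⟩, hlt, hmod⟩
    refine ⟨(r.1 / p.2, m ^ a * n ^ b), (inSub_iff hm hn).2 ⟨⟨a, b, rfl⟩, ?_⟩, ?_⟩
    · exact Nat.div_lt_of_lt_mul (hab ▸ hlt)
    · have : r.1 % p.2 = p.1 := by rw [hmod, Nat.mod_eq_of_lt hp]
      refine Prod.ext ?_ hab.symm
      simp only [nmul]
      rw [← this, Nat.mod_add_div]

theorem nmul_left_cancel {p q r : ℕ × ℕ} (hp : 0 < p.2) (h : nmul p q = nmul p r) : q = r := by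
  obtain ⟨h₁, h₂⟩ := Prod.ext_iff.1 h
  simp only [nmul, add_right_inj] at h₁ h₂
  exact Prod.ext (Nat.eq_of_mul_eq_mul_left hp h₁) (Nat.eq_of_mul_eq_mul_left hp h₂)

theorem pow_mul_pow_dvd_iff {m n : ℕ} (hm : 2 ≤ m) (hn : 2 ≤ n) (h : Nat.Coprime m n)
    {a b c d : ℕ} : m ^ a * n ^ b ∣ m ^ c * n ^ d ↔ a ≤ c ∧ b ≤ d := by
  constructor
  · intro hd
    have h₁ : m ^ a ∣ m ^ c := (h.pow a d).dvd_of_dvd_mul_right ((dvd_mul_right _ _).trans hd)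
    have h₂ : n ^ b ∣ n ^ d :=
      (h.symm.pow b c).dvd_of_dvd_mul_left ((dvd_mul_left _ _).trans hd)
    exact ⟨(Nat.pow_dvd_pow_iff_le_right hm).1 h₁, (Nat.pow_dvd_pow_iff_le_right hn).1 h₂⟩
  · rintro ⟨h₁, h₂⟩
    exact mul_dvd_mul (pow_dvd_pow _ h₁) (pow_dvd_pow _ h₂)

theorem pow_mul_pow_mul_sub {m n a b c d : ℕ} (h₁ : a ≤ c) (h₂ : b ≤ d) :
    m ^ c * n ^ d = m ^ a * n ^ b * (m ^ (c - a) * n ^ (d - b)) := by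
  rw [mul_mul_mul_comm, ← pow_add, ← pow_add, Nat.add_sub_cancel' h₁, Nat.add_sub_cancel' h₂]

theorem lcm_pow_mul_pow {m n : ℕ} (h : Nat.Coprime m n) (a b c d : ℕ) :
    Nat.lcm (m ^ a * n ^ b) (m ^ c * n ^ d) = m ^ max a c * n ^ max b d := by
  refine Nat.dvd_antisymm (Nat.lcm_dvd ?_ ?_) ?_
  · exact mul_dvd_mul (pow_dvd_pow _ (le_max_left ..)) (pow_dvd_pow _ (le_max_left ..))
  · exact mul_dvd_mul (pow_dvd_pow _ (le_max_right ..)) (pow_dvd_pow _ (le_max_right ..))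
  · have h₁ := Nat.dvd_lcm_left (m ^ a * n ^ b) (m ^ c * n ^ d)
    have h₂ := Nat.dvd_lcm_right (m ^ a * n ^ b) (m ^ c * n ^ d)
    refine (h.pow _ _).mul_dvd_of_dvd_of_dvd ?_ ?_
    · rcases max_choice a c with e | e <;> rw [e]
      exacts [(dvd_mul_right _ _).trans h₁, (dvd_mul_right _ _).trans h₂]
    · rcases max_choice b d with e | e <;> rw [e]
      exacts [(dvd_mul_left _ _).trans h₁, (dvd_mul_left _ _).trans h₂]

theorem exists_sRLCM {m n : ℕ} (hm : 2 ≤ m) (hn : 2 ≤ n) (h : Nat.Coprime m n) {p q : ℕ × ℕ}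
    (hp : InSub m n p) (hq : InSub m n q) (hw : ∃ w, SRCM m n p q w) :
    ∃ w, InSub m n w ∧ SRLCM m n p q w := by
  have hm0 : 0 < m := by omega
  have hn0 : 0 < n := by omega
  obtain ⟨⟨a, b, hab⟩, hp⟩ := (inSub_iff hm0 hn0).1 hp
  obtain ⟨⟨c, d, hcd⟩, hq⟩ := (inSub_iff hm0 hn0).1 hq
  obtain ⟨w, hpw, hqw⟩ := hw
  obtain ⟨-, -, hpw⟩ := (sRmul_iff hm0 hn0 hp).1 hpw
  obtain ⟨-, -, hqw⟩ := (sRmul_iff hm0 hn0 hq).1 hqw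
  have hL := lcm_pow_mul_pow h a b c d
  rw [← hab, ← hcd] at hL
  have hL0 : 0 < Nat.lcm p.2 q.2 := Nat.lcm_pos (by omega) (by omega)
  have hlt : w.1 % Nat.lcm p.2 q.2 < Nat.lcm p.2 q.2 := Nat.mod_lt _ hL0
  have hmod : w.1 % Nat.lcm p.2 q.2 ≡ w.1 [MOD Nat.lcm p.2 q.2] := Nat.mod_modEq _ _
  refine ⟨(w.1 % Nat.lcm p.2 q.2, Nat.lcm p.2 q.2),
    (inSub_iff hm0 hn0).2 ⟨⟨_, _, hL⟩, hlt⟩, ⟨?_, ?_⟩, ?_⟩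
  · refine (sRmul_iff hm0 hn0 hp).2 ⟨⟨max a c - a, max b d - b, ?_⟩, hlt,
      (hmod.of_dvd (Nat.dvd_lcm_left ..)).trans hpw⟩
    refine hL.trans ?_
    rw [hab, ← pow_mul_pow_mul_sub (le_max_left ..) (le_max_left ..)]
  · refine (sRmul_iff hm0 hn0 hq).2 ⟨⟨max a c - c, max b d - d, ?_⟩, hlt,
      (hmod.of_dvd (Nat.dvd_lcm_right ..)).trans hqw⟩
    refine hL.trans ?_
    rw [hcd, ← pow_mul_pow_mul_sub (le_max_right ..) (le_max_right ..)]
  · rintro s ⟨hps, hqs⟩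
    obtain ⟨⟨e, f, hs⟩, hslt, hps⟩ := (sRmul_iff hm0 hn0 hp).1 hps
    obtain ⟨⟨e', f', hs'⟩, -, hqs⟩ := (sRmul_iff hm0 hn0 hq).1 hqs
    have hsef : s.2 = m ^ (a + e) * n ^ (b + f) := by rw [hs, hab]; ring
    have hdvd : Nat.lcm p.2 q.2 ∣ s.2 :=
      Nat.lcm_dvd (hs ▸ dvd_mul_right _ _) (hs' ▸ dvd_mul_right _ _)
    rw [hL, hsef, pow_mul_pow_dvd_iff hm hn h] at hdvd
    refine (sRmul_iff hm0 hn0 hlt).2 ⟨⟨a + e - max a c, b + f - max b d, ?_⟩, hslt, ?_⟩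
    · change s.2 = Nat.lcm p.2 q.2 * _
      rw [hsef, hL, ← pow_mul_pow_mul_sub hdvd.1 hdvd.2]
    · exact (Nat.mod_lcm (hps.trans hpw.symm) (hqs.trans hqw.symm)).trans hmod.symm

namespace FTheta

variable {m n : ℕ}

/-- The generator `x_i`. -/
def x (n : ℕ) (i : Fin m) : FTheta m n :=
  (conGen (FTrel m n)).mk' (FreeMonoid.of (Sum.inl i))

/-- The generator `y_j`. -/
def y (m : ℕ) (j : Fin n) : FTheta m n :=
  (conGen (FTrel m n)).mk' (FreeMonoid.of (Sum.inr j))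

theorem y_mul_x {j : Fin n} {i i' : Fin m} {j' : Fin n}
    (h : (j : ℕ) + i * n = i' + j' * m) : y m j * x n i = x n i' * y m j' :=
  (Con.eq _).2 (ConGen.Rel.of _ _ ⟨j, i, i', j', h, rfl, rfl⟩)

/-- The homomorphism out of `𝔽θ⁺` determined by images of the generators that satisfy the
commutation relations. -/
def lift {M : Type*} [Monoid M] (f : Fin m → M) (g : Fin n → M)
    (h : ∀ (j : Fin n) (i i' : Fin m) (j' : Fin n), (j : ℕ) + i * n = i' + j' * m →
      g j * f i = f i' * g j') : FTheta m n →* M :=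
  Con.lift _ (FreeMonoid.lift (Sum.elim f g)) <| Con.conGen_le.2 <| by
    rintro _ _ ⟨j, i, i', j', hθ, rfl, rfl⟩
    simpa [Con.ker_rel] using h j i i' j' hθ

/-- The degree of an element of `𝔽θ⁺`. -/
def degree : FTheta m n →* Multiplicative (ℕ × ℕ) :=
  lift (fun _ => .ofAdd (1, 0)) (fun _ => .ofAdd (0, 1)) fun _ _ _ _ _ => mul_comm _ _

/-- The action of `𝔽θ⁺` on `ℕ` by the affine maps `t ↦ i + m t` and `t ↦ j + n t`. -/
def affine : FTheta m n →* Function.End ℕ :=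
  lift (fun i t => i + m * t) (fun j t => j + n * t) fun j i i' j' h => by
    funext t
    change (j : ℕ) + n * (i + m * t) = i' + m * (j' + n * t)
    linarith [mul_left_comm n m t, mul_comm n (i : ℕ), mul_comm m (j' : ℕ)]

@[simp] theorem degree_x (i : Fin m) : degree (x n i) = .ofAdd (1, 0) := rfl

@[simp] theorem degree_y (j : Fin n) : degree (y m j) = .ofAdd (0, 1) := rfl

theorem eq_one_of_degree_eq_one {t : FTheta m n} (h : degree t = 1) : t = 1 := by
  induction t using Con.induction_on with
  | H w =>
  induction w using FreeMonoid.casesOn with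
  | one => rfl
  | of_mul s w =>
    exfalso
    rw [Con.coe_mul, map_mul] at h
    have h' := congrArg Multiplicative.toAdd h
    rw [toAdd_mul, toAdd_one, Prod.ext_iff] at h'
    cases s with
    | inl i =>
      have := h'.1
      change 1 + _ = 0 at this
      omega
    | inr j =>
      have := h'.2
      change 1 + _ = 0 at this
      omega

theorem mul_y_injective (i : Fin m) {j j' : Fin n} (h : x n i * y m j = x n i * y m j') :
    j = j' := by
  have h₁ : (i : ℕ) + m * (j + n * 0) = i + m * (j' + n * 0) :=
    congrFun (congrArg affine h) 0
  have : m * (j : ℕ) = m * j' := by simpa using h₁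
  exact Fin.ext (Nat.eq_of_mul_eq_mul_left i.pos this)

/-- A right multiple of both `x i` and `y j` dividing an element of degree `(1, 1)` equals it. -/
theorem eq_of_mul_eq {i : Fin m} {j : Fin n} {r z t : FTheta m n}
    (hr : IsRCM (· * ·) (x n i) (y m j) r) (hz : degree z = .ofAdd (1, 1)) (ht : r * t = z) :
    r = z := by
  obtain ⟨⟨u, rfl⟩, ⟨v, hv⟩⟩ := hr
  suffices t = 1 by simpa [this] using ht
  apply eq_one_of_degree_eq_one
  have h₁ := congrArg Multiplicative.toAdd (congrArg degree hv)
  have h₂ := congrArg Multiplicative.toAdd ((congrArg degree ht).trans hz)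
  simp only [map_mul, degree_x, degree_y, toAdd_mul, toAdd_ofAdd, Prod.ext_iff, Prod.fst_add,
    Prod.snd_add] at h₁ h₂
  apply Multiplicative.toAdd.injective
  rw [toAdd_one]
  refine Prod.ext ?_ ?_
  · change _ = 0
    omega
  · change _ = 0
    omega

theorem not_rightLCMMonoid {p a b : ℕ} (hp : 1 < p) (ha : 0 < a) (hb : 0 < b)
    (hma : m = p * a) (hnb : n = p * b) : ¬ RightLCMMonoid (FTheta m n) := by
  rintro ⟨-, hlcm⟩
  have ham : a < m := hma ▸ (Nat.lt_mul_iff_one_lt_left ha).2 hp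
  have hbn : b < n := hnb ▸ (Nat.lt_mul_iff_one_lt_left hb).2 hp
  let i₀ : Fin m := ⟨0, by omega⟩
  let j₀ : Fin n := ⟨0, by omega⟩
  have h₁ : IsRCM (· * ·) (x n i₀) (y m j₀) (x n i₀ * y m j₀) :=
    ⟨⟨_, rfl⟩, ⟨x n i₀, y_mul_x (by simp [i₀, j₀])⟩⟩
  have h₂ : IsRCM (· * ·) (x n i₀) (y m j₀) (x n i₀ * y m ⟨b, hbn⟩) := by
    refine ⟨⟨_, rfl⟩, ⟨x n ⟨a, ham⟩, y_mul_x ?_⟩⟩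
    simp only [i₀, j₀, zero_add]
    rw [hma, hnb]
    ring
  obtain ⟨r, hr, hmin⟩ := hlcm _ _ ⟨_, h₁⟩
  obtain ⟨t₁, ht₁⟩ := hmin _ h₁
  obtain ⟨t₂, ht₂⟩ := hmin _ h₂
  have h := (eq_of_mul_eq hr rfl ht₁).symm.trans (eq_of_mul_eq hr rfl ht₂)
  exact hb.ne (congrArg Fin.val (mul_y_injective i₀ h))

end FTheta

theorem stmt18 (m n : ℕ) (hm : 2 ≤ m) (hn : 2 ≤ n) :
    (∀ p a b : ℕ, 1 < p → m = p * a → n = p * b →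
      (p + 0 * (p * b) = p + 0 * (p * a) ∧ p + a * (p * b) = p + b * (p * a)) ∧
      ¬ RightLCMMonoid (FTheta m n)) ∧
    (Nat.gcd m n = 1 →
      (∀ p q r : ℕ × ℕ, InSub m n p → InSub m n q → InSub m n r →
        nmul p q = nmul p r → q = r) ∧
      (∀ p q : ℕ × ℕ, InSub m n p → InSub m n q →
        (∃ w, SRCM m n p q w) → ∃ w, InSub m n w ∧ SRLCM m n p q w)) := by
  refine ⟨fun p a b hp hma hnb => ⟨⟨by simp, by ring⟩, ?_⟩, fun h => ⟨?_, ?_⟩⟩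
  · refine FTheta.not_rightLCMMonoid hp (Nat.pos_of_ne_zero ?_) (Nat.pos_of_ne_zero ?_) hma hnb
    · rintro rfl
      omega
    · rintro rfl
      omega
  · intro p q r hp _ _
    have := ((inSub_iff (by omega) (by omega)).1 hp).2
    exact nmul_left_cancel (by omega)
  · intro p q hp hq
    exact exists_sRLCM hm hn h hp hq
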